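/- arXiv:2201.07270 — 5 statements merged into one kernel-verified Lean document; each statement's English description precedes it below -/
import Mathlib

section
/- The monomial z_1^2⋯z_{k−1}^2 z_k belongs to BD_k + span(L_k^2 ∪ W_k), and for every 1 ≤ i ≤ k−1 the monomial z_1^2⋯z_{i−1}^2 · z_i · z_{i+1}^2⋯z_{k−1}^2 · z_k belongs to BD_k + span(L_k^2 ∪ W_k). -/
open MvPolynomial

/-- The set of monomials `z₁^{m₁}⋯z_k^{m_k}` with all `m_j ∈ {0,1,2}`;
its span is the space `R_k = ℂ[z₁,…,z_k]_{≤2,…,2}`. -/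
def Rmonomials (k : ℕ) : Set (MvPolynomial (Fin k) ℂ) :=
  { m | ∃ e : Fin k →₀ ℕ, (∀ j, e j ≤ 2) ∧ m = monomial e 1 }

/-- The space `R_k = ℂ[z₁,…,z_k]_{≤2,…,2}`. -/
noncomputable def Rspace (k : ℕ) : Submodule ℂ (MvPolynomial (Fin k) ℂ) :=
  Submodule.span ℂ (Rmonomials k)

/-- The set `BD_k` of polynomials of `R_k` admitting a boundary decomposition
`p = (z₁+η)F₁ + ∑_{i=2}^k (z_{i−1}−z_i−1)F_i` with `F₁` invariant under `z₁ ↦ −z₁`,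
`(z₁+η)F₁ ∈ R_k`, each `F_i` (for `i ≥ 2`) invariant under exchanging `z_{i−1}, z_i`,
and `(z_{i−1}−z_i−1)F_i ∈ R_k`. -/
def BDset (k : ℕ) [NeZero k] (η : ℝ) : Set (MvPolynomial (Fin k) ℂ) :=
  { p | p ∈ Rspace k ∧
      ∃ F : Fin k → MvPolynomial (Fin k) ℂ,
        (aeval (fun j : Fin k => if j = 0 then -(X 0) else X j) (F 0) = F 0) ∧
        ((X 0 + C (η : ℂ)) * F 0 ∈ Rspace k) ∧
        (∀ i : Fin k, i ≠ 0 →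
          rename (Equiv.swap (i - 1) i) (F i) = F i ∧
            (X (i - 1) - X i - 1) * F i ∈ Rspace k) ∧
        p = (X 0 + C (η : ℂ)) * F 0 +
              ∑ i ∈ Finset.univ.filter (fun i : Fin k => i ≠ 0),
                (X (i - 1) - X i - 1) * F i }

/-- The linear map `L_{r,k}`: sum, over subsets `S` of `{1,…,k}` of size `k−r`, of the
substitution of `p` at the tuple whose coordinates in `S` (in increasing order) are
`−η, −η−1, …, −η−(k−r−1)` and whose remaining coordinates (in increasing order) are the
variables `x₁,…,x_r` (indexed here by `0,…,r−1` in `MvPolynomial ℕ ℂ`). -/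
noncomputable def Lmap (k : ℕ) (η : ℝ) (r : ℕ) (p : MvPolynomial (Fin k) ℂ) :
    MvPolynomial ℕ ℂ :=
  ∑ S ∈ Finset.powersetCard (k - r) (Finset.univ : Finset (Fin k)),
    aeval (fun j : Fin k =>
      if j ∈ S then C (-(η : ℂ) - ((S.filter (fun i => i < j)).card : ℂ))
      else X (((Finset.univ \ S).filter (fun i => i < j)).card)) p

/-- The set `SH_k`: polynomials `p ∈ R_k` such that for all `0 ≤ r ≤ k` the coefficient
of `x₁²⋯x_r²` in `L_{r,k}(p)` vanishes. -/
def SHset (k : ℕ) (η : ℝ) : Set (MvPolynomial (Fin k) ℂ) :=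
  { p | p ∈ Rspace k ∧
      ∀ r ≤ k, coeff (∑ i ∈ Finset.range r, Finsupp.single i 2) (Lmap k η r p) = 0 }

/-- The set `L_k^i` of monomials `z₁^{m₁}⋯z_k^{m_k}` with all `m_j ∈ {0,1,2}` and
exponent of `z_k` equal to `i`. -/
def Lset (k : ℕ) (i : ℕ) : Set (MvPolynomial (Fin k) ℂ) :=
  { m | ∃ e : Fin k →₀ ℕ, (∀ j, e j ≤ 2) ∧ (∀ j : Fin k, (j : ℕ) = k - 1 → e j = i) ∧
      m = monomial e 1 }

/-- The set `W_k` consisting of the monomial `z₁²⋯z_k²` together with, for each `j`, the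
monomial with exponent `2` in every variable except exponent `1` in `z_j`. -/
def Wset (k : ℕ) : Set (MvPolynomial (Fin k) ℂ) :=
  { m | m = monomial (Finsupp.equivFunOnFinite.symm fun _ : Fin k => 2) 1 ∨
      ∃ j : Fin k,
        m = monomial (Finsupp.equivFunOnFinite.symm fun i : Fin k => if i = j then 1 else 2) 1 }

/-- The monomial of `MvPolynomial (Fin k) ℂ` whose exponents are the first `k` values of `f`. -/
noncomputable def wordMonomial (k : ℕ) (f : ℕ → ℕ) : MvPolynomial (Fin k) ℂ :=
  monomial (Finsupp.equivFunOnFinite.symm fun j : Fin k => f j) 1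

/-- The subspace `BD_k + span(L_k² ∪ W_k)`. -/
noncomputable def boundarySpace (k : ℕ) [NeZero k] (η : ℝ) :
    Submodule ℂ (MvPolynomial (Fin k) ℂ) :=
  Submodule.span ℂ (BDset k η) ⊔ Submodule.span ℂ (Lset k 2 ∪ Wset k)

lemma wordMonomial_eq_prod (k : ℕ) (f : ℕ → ℕ) :
    wordMonomial k f = ∏ j : Fin k, X j ^ f j := by
  rw [wordMonomial, monomial_eq, C_1, one_mul, Finsupp.prod_fintype _ _ (by simp)]
  rfl

lemma wordMonomial_congr {k : ℕ} {f g : ℕ → ℕ} (h : ∀ l < k, f l = g l) :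
    wordMonomial k f = wordMonomial k g := by
  simp only [wordMonomial_eq_prod]
  exact Finset.prod_congr rfl fun j _ => by rw [h j j.2]

lemma wordMonomial_mem_Rspace (k : ℕ) {f : ℕ → ℕ} (hf : ∀ l, f l ≤ 2) :
    wordMonomial k f ∈ Rspace k :=
  Submodule.subset_span ⟨_, fun j => hf j, rfl⟩

lemma X_mul_wordMonomial {k : ℕ} (f : ℕ → ℕ) (j : Fin k) :
    X j * wordMonomial k f = wordMonomial k (Function.update f j (f j + 1)) := by
  rw [wordMonomial, wordMonomial, X, monomial_mul, one_mul]
  congr 2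
  ext l
  by_cases h : l = j
  · subst h
    simp [add_comm]
  · have h' : (l : ℕ) ≠ j := fun e => h (Fin.ext e)
    simp [Function.update_of_ne h', Finsupp.single_eq_of_ne h]

lemma rename_swap_wordMonomial {k : ℕ} {f : ℕ → ℕ} {i j : Fin k} (h : f i = f j) :
    rename (Equiv.swap i j) (wordMonomial k f) = wordMonomial k f := by
  simp only [wordMonomial_eq_prod, map_prod, map_pow, rename_X]
  rw [← Equiv.prod_comp (Equiv.swap i j) fun l : Fin k => (X l : MvPolynomial (Fin k) ℂ) ^ f l]
  refine Finset.prod_congr rfl fun l _ => ?_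
  congr 1
  rcases eq_or_ne l i with rfl | hi
  · rw [Equiv.swap_apply_left, h]
  rcases eq_or_ne l j with rfl | hj
  · rw [Equiv.swap_apply_right, h]
  rw [Equiv.swap_apply_of_ne_of_ne hi hj]

lemma mul_symmetric_mem_BDset {k : ℕ} [NeZero k] (η : ℝ) {i : Fin k} (hi : i ≠ 0)
    {G : MvPolynomial (Fin k) ℂ} (hG : rename (Equiv.swap (i - 1) i) G = G)
    (hR : (X (i - 1) - X i - 1) * G ∈ Rspace k) :
    (X (i - 1) - X i - 1) * G ∈ BDset k η := by
  refine ⟨hR, Pi.single i G, ?_, ?_, fun l _ => ?_, ?_⟩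
  · simp [Pi.single_eq_of_ne hi.symm]
  · simp [Pi.single_eq_of_ne hi.symm]
  · rcases eq_or_ne l i with rfl | hl
    · simpa using ⟨hG, hR⟩
    · simp [Pi.single_eq_of_ne hl]
  · rw [Finset.sum_eq_single_of_mem i (by simpa using hi)
      fun l _ hl => by rw [Pi.single_eq_of_ne hl, mul_zero]]
    simp [Pi.single_eq_of_ne hi.symm]

/-- The relation `z_a² z_{a+1} ≡ z_a z_{a+1}² + z_a z_{a+1}` between adjacent variables. -/
lemma adjacent_relation_mem {k : ℕ} [NeZero k] (η : ℝ) {f : ℕ → ℕ} (hf : ∀ l, f l ≤ 2) {a : ℕ}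
    (ha : a + 1 < k) (h0 : f a = 1) (h1 : f (a + 1) = 1) :
    wordMonomial k (Function.update f a 2) - wordMonomial k (Function.update f (a + 1) 2)
      - wordMonomial k f ∈ boundarySpace k η := by
  set i : Fin k := ⟨a + 1, ha⟩
  have hi : i ≠ 0 := fun h => by simpa [i] using congrArg Fin.val h
  have hpred : i - 1 = ⟨a, by omega⟩ := by
    ext
    rw [Fin.val_sub_one_of_ne_zero hi]
    rfl
  have hle (b : ℕ) : ∀ l, Function.update f b 2 l ≤ 2 := fun l => by
    by_cases h : l = b
    · simp [h]
    · simpa [Function.update_of_ne h] using hf l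
  have hmul : (X (i - 1) - X i - 1) * wordMonomial k f =
      wordMonomial k (Function.update f a 2) - wordMonomial k (Function.update f (a + 1) 2)
        - wordMonomial k f := by
    rw [sub_mul, sub_mul, one_mul, X_mul_wordMonomial, X_mul_wordMonomial, hpred]
    simp [i, h0, h1]
  refine Submodule.mem_sup_left (Submodule.subset_span ?_)
  rw [← hmul]
  refine mul_symmetric_mem_BDset η hi (rename_swap_wordMonomial ?_) ?_
  · rw [hpred]
    simp [i, h0, h1]
  · rw [hmul]
    exact sub_mem (sub_mem (wordMonomial_mem_Rspace k (hle a))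
      (wordMonomial_mem_Rspace k (hle (a + 1)))) (wordMonomial_mem_Rspace k hf)

lemma shift_relation_mem {k : ℕ} [NeZero k] (η : ℝ) {f : ℕ → ℕ} (hf : ∀ l, f l ≤ 2) {a : ℕ}
    (h1 : ∀ l, a ≤ l → f l = 1) (n : ℕ) (hn : a + n < k) :
    wordMonomial k (Function.update f a 2) - wordMonomial k (Function.update f (a + n) 2)
      - (n : ℂ) • wordMonomial k f ∈ boundarySpace k η := by
  induction n with
  | zero => simp
  | succ n ih =>
    have := add_mem (ih (by omega)) (adjacent_relation_mem η hf (a := a + n) (by omega)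
      (h1 _ (by omega)) (h1 _ (by omega)))
    convert this using 1
    push_cast
    rw [add_smul, one_smul, ← add_assoc]
    abel

lemma wordMonomial_mem_of_last_eq_two {k : ℕ} [NeZero k] (η : ℝ) {f : ℕ → ℕ} (hf : ∀ l, f l ≤ 2)
    (hlast : f (k - 1) = 2) : wordMonomial k f ∈ boundarySpace k η :=
  Submodule.mem_sup_right (Submodule.subset_span
    (Or.inl ⟨_, fun j => hf j, fun j hj => by simp [hj, hlast], rfl⟩))

/-- Modulo `BD_k + span(L_k² ∪ W_k)`, raising to `2` the first exponent of a terminal block of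
ones multiplies the monomial by the length of the rest of the block. -/
lemma update_sub_smul_mem {k : ℕ} [NeZero k] (η : ℝ) {f : ℕ → ℕ} (hf : ∀ l, f l ≤ 2) {a : ℕ}
    (ha : a < k) (h1 : ∀ l, a ≤ l → f l = 1) :
    wordMonomial k (Function.update f a 2) - ((k - 1 - a : ℕ) : ℂ) • wordMonomial k f
      ∈ boundarySpace k η := by
  have hmem := shift_relation_mem (k := k) η hf h1 (k - 1 - a) (by omega)
  rw [show a + (k - 1 - a) = k - 1 by omega] at hmem
  have hlast : wordMonomial k (Function.update f (k - 1) 2) ∈ boundarySpace k η := by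
    refine wordMonomial_mem_of_last_eq_two η (fun l => ?_) (by simp)
    by_cases h : l = k - 1
    · simp [h]
    · simpa [Function.update_of_ne h] using hf l
  convert add_mem hmem hlast using 1
  abel

lemma twos_then_ones_mem {k : ℕ} [NeZero k] (η : ℝ) {a : ℕ} (ha : a ≤ k - 1) :
    wordMonomial k (fun l => if l < a then 2 else 1) ∈ boundarySpace k η := by
  have hk : 0 < k := Nat.pos_of_ne_zero (NeZero.ne k)
  induction ha using Nat.decreasingInduction with
  | self =>
    refine Submodule.mem_sup_right (Submodule.subset_span (Or.inr (Or.inr ⟨⟨k - 1, by omega⟩, ?_⟩)))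
    rw [wordMonomial]
    congr 2
    ext l
    simp only [Fin.ext_iff, Finsupp.equivFunOnFinite_symm_apply_apply]
    split_ifs <;> omega
  | of_succ a ha ih =>
    have hmem := update_sub_smul_mem η (f := fun l => if l < a then 2 else 1)
      (fun l => by split_ifs <;> omega) (show a < k by omega) (fun l hl => if_neg (by omega))
    have hupd : Function.update (fun l => if l < a then 2 else 1) a 2
        = fun l => if l < a + 1 then 2 else 1 := by
      ext l
      simp only [Function.update_apply]
      split_ifs <;> omega
    rw [hupd] at hmem
    have hsmul := sub_mem ih hmem
    rw [sub_sub_cancel] at hsmul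
    exact (Submodule.smul_mem_iff _ (Nat.cast_ne_zero.mpr (by omega))).mp hsmul

lemma wordMonomial_mem_of_eventually_one {k : ℕ} [NeZero k] (η : ℝ) {a : ℕ} (ha : a ≤ k) :
    ∀ f : ℕ → ℕ, (∀ l, f l = 1 ∨ f l = 2) → (∀ l, a ≤ l → f l = 1) →
      wordMonomial k f ∈ boundarySpace k η := by
  induction a with
  | zero =>
    intro f _ h1
    have := twos_then_ones_mem (k := k) η (Nat.zero_le _)
    rwa [wordMonomial_congr (g := f) fun l _ => by simp [h1 l (Nat.zero_le l)]] at this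
  | succ a ih =>
    intro f hf h1
    have hone : ∀ l, a ≤ l → Function.update f a 1 l = 1 := fun l hl => by
      rw [Function.update_apply]
      split_ifs with h
      · rfl
      · exact h1 l (by omega)
    have hval : ∀ l, Function.update f a 1 l = 1 ∨ Function.update f a 1 l = 2 := fun l => by
      rw [Function.update_apply]
      split_ifs
      · exact Or.inl rfl
      · exact hf l
    have hmem := ih (by omega) _ hval hone
    rcases hf a with h | h
    · rwa [← h, Function.update_eq_self] at hmem
    · have hrel := update_sub_smul_mem (k := k) η (fun l => by have := hval l; omega) (by omega) hone
      rw [Function.update_idem, ← h, Function.update_eq_self] at hrel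
      simpa using add_mem hrel (Submodule.smul_mem _ ((k - 1 - a : ℕ) : ℂ) hmem)

/-- Every monomial with all exponents in `{1, 2}` lies in `BD_k + span(L_k² ∪ W_k)`. -/
lemma wordMonomial_mem (k : ℕ) [NeZero k] (η : ℝ) (f : ℕ → ℕ) (hf : ∀ l, f l = 1 ∨ f l = 2) :
    wordMonomial k f ∈ boundarySpace k η := by
  rw [wordMonomial_congr (g := fun l => if l < k then f l else 1) fun l hl => (if_pos hl).symm]
  refine wordMonomial_mem_of_eventually_one η le_rfl _ (fun l => ?_) fun l hl => if_neg (by omega)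
  split_ifs
  · exact hf l
  · exact Or.inl rfl

lemma X_eq_prod_ite {k : ℕ} (a : Fin k) :
    (X a : MvPolynomial (Fin k) ℂ) = ∏ j : Fin k, if (j : ℕ) = a then X j else 1 := by
  simp [← Fin.ext_iff]

/-- Proposition 4.5 of the paper: `z₁²⋯z_{k−1}² z_k ∈ BD_k + span(L_k² ∪ W_k)`, and for
`1 ≤ i ≤ k−1`, `z₁²⋯z_{i−1}² z_i z_{i+1}²⋯z_{k−1}² z_k ∈ BD_k + span(L_k² ∪ W_k)`. -/
theorem condition_II (k : ℕ) [NeZero k] (η : ℝ) (hη : 0 < η) :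
    ((∏ j ∈ Finset.univ.filter (fun j : Fin k => (j : ℕ) < k - 1), X j ^ 2) *
        X (⟨k - 1, by have := Nat.pos_of_ne_zero (NeZero.ne k); omega⟩ : Fin k)
      ∈ Submodule.span ℂ (BDset k η) ⊔ Submodule.span ℂ (Lset k 2 ∪ Wset k)) ∧
    ∀ (i : ℕ) (hi1 : 1 ≤ i) (hi2 : i ≤ k - 1),
      (∏ j ∈ Finset.univ.filter (fun j : Fin k => (j : ℕ) < i - 1), X j ^ 2) *
          X (⟨i - 1, by omega⟩ : Fin k) *
          (∏ j ∈ Finset.univ.filter (fun j : Fin k => i ≤ (j : ℕ) ∧ (j : ℕ) < k - 1),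
            X j ^ 2) *
          X (⟨k - 1, by omega⟩ : Fin k)
        ∈ Submodule.span ℂ (BDset k η) ⊔ Submodule.span ℂ (Lset k 2 ∪ Wset k) := by
  change _ ∈ boundarySpace k η ∧ ∀ (i : ℕ) (_ : 1 ≤ i) (_ : i ≤ k - 1), _ ∈ boundarySpace k η
  constructor
  · convert wordMonomial_mem k η (fun l => if l < k - 1 then 2 else 1)
      (fun l => by split_ifs <;> simp) using 1
    rw [wordMonomial_eq_prod, Finset.prod_filter, X_eq_prod_ite, ← Finset.prod_mul_distrib]
    refine Finset.prod_congr rfl fun j _ => ?_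
    have := j.2
    dsimp only
    split_ifs <;> first | omega | simp
  · intro i hi1 hi2
    convert wordMonomial_mem k η (fun l => if l = i - 1 ∨ l = k - 1 then 1 else 2)
      (fun l => by split_ifs <;> simp) using 1
    rw [wordMonomial_eq_prod, Finset.prod_filter, Finset.prod_filter, X_eq_prod_ite,
      X_eq_prod_ite, ← Finset.prod_mul_distrib, ← Finset.prod_mul_distrib,
      ← Finset.prod_mul_distrib]
    refine Finset.prod_congr rfl fun j _ => ?_
    have := j.2
    dsimp only
    split_ifs <;> first | omega | simp
end

section
/- The polynomial z_1 z_2⋯z_{k−1} − (k−1)! belongs to BD_k + span(L_k^1 ∪ L_k^2). -/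
open MvPolynomial

/-- A squarefree product of variables is the monomial whose exponent is an indicator function. -/
lemma prod_X_eq_monomial_indicator {k : ℕ} (A : Finset (Fin k)) :
    (∏ j ∈ A, X j : MvPolynomial (Fin k) ℂ) =
      monomial (Finsupp.equivFunOnFinite.symm fun j => if j ∈ A then 1 else 0) 1 := by
  rw [monomial_eq, Finsupp.prod_fintype _ _ (by simp)]
  simp [pow_ite, Finset.prod_ite_mem]

lemma prod_X_mem_Rspace {k : ℕ} (A : Finset (Fin k)) :
    (∏ j ∈ A, X j : MvPolynomial (Fin k) ℂ) ∈ Rspace k := by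
  refine Submodule.subset_span ⟨_, fun j => ?_, prod_X_eq_monomial_indicator A⟩
  simp only [Finsupp.equivFunOnFinite_symm_apply_apply]
  split_ifs <;> simp

lemma X_mul_prod_X_mem_Rspace {k : ℕ} {i : Fin k} {A : Finset (Fin k)} (hi : i ∉ A) :
    (X i * ∏ j ∈ A, X j : MvPolynomial (Fin k) ℂ) ∈ Rspace k :=
  Finset.prod_insert (f := fun j => (X j : MvPolynomial (Fin k) ℂ)) hi ▸
    prod_X_mem_Rspace (insert i A)

/-- If `A` avoids `i - 1` and `i`, then `(z_{i-1} - z_i - 1) ∏_{j ∈ A} z_j` admits a boundary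
decomposition. -/
lemma sub_sub_one_mul_prod_X_mem_BDset {k : ℕ} [NeZero k] (η : ℝ) {i : Fin k} (hi : i ≠ 0)
    {A : Finset (Fin k)} (hA : i ∉ A) (hA' : i - 1 ∉ A) :
    (X (i - 1) - X i - 1) * ∏ j ∈ A, X j ∈ BDset k η := by
  have hR : (X (i - 1) - X i - 1) * ∏ j ∈ A, X j ∈ Rspace k := by
    rw [sub_mul, sub_mul, one_mul]
    exact sub_mem (sub_mem (X_mul_prod_X_mem_Rspace hA') (X_mul_prod_X_mem_Rspace hA))
      (prod_X_mem_Rspace A)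
  refine ⟨hR, Pi.single i (∏ j ∈ A, X j), ?_, ?_, fun l _ => ?_, ?_⟩
  · simp [Pi.single_eq_of_ne hi.symm]
  · simp [Pi.single_eq_of_ne hi.symm]
  · obtain rfl | hl := eq_or_ne l i
    · refine ⟨?_, by simpa using hR⟩
      simp only [Pi.single_eq_same, map_prod, rename_X]
      refine Finset.prod_congr rfl fun j hj => ?_
      rw [Equiv.swap_apply_of_ne_of_ne] <;> rintro rfl <;> contradiction
    · simp [Pi.single_eq_of_ne hl]
  · rw [Pi.single_eq_of_ne hi.symm, mul_zero, zero_add,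
      Finset.sum_eq_single_of_mem i (by simpa using hi)
        fun l _ hl => by rw [Pi.single_eq_of_ne hl, mul_zero], Pi.single_eq_same]

/-- Modulo boundary decompositions and monomials divisible by the last variable, the variable
with `n` variables after it acts as multiplication by `n` on squarefree products of the variables
before it. -/
lemma X_mul_prod_X_sub_mem {k : ℕ} [NeZero k] (η : ℝ) (n : ℕ) :
    ∀ i : Fin k, (i : ℕ) + n = k - 1 → ∀ A : Finset (Fin k), (∀ j ∈ A, j < i) →
      X i * (∏ j ∈ A, X j) - C (n : ℂ) * ∏ j ∈ A, X j ∈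
        Submodule.span ℂ (BDset k η) ⊔ Submodule.span ℂ (Lset k 1 ∪ Lset k 2) := by
  induction n with
  | zero =>
    intro i hi A hA
    have hiA : i ∉ A := fun h => lt_irrefl _ (hA i h)
    rw [Nat.cast_zero, C_0, zero_mul, sub_zero, ← Finset.prod_insert hiA]
    refine Submodule.mem_sup_right (Submodule.subset_span (Or.inl
      ⟨_, fun j => ?_, fun j hj => ?_, prod_X_eq_monomial_indicator _⟩))
    · simp only [Finsupp.equivFunOnFinite_symm_apply_apply]
      split_ifs <;> simp
    · obtain rfl : j = i := Fin.ext (by omega)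
      simp
  | succ n ih =>
    intro i hi A hA
    obtain ⟨l, hl⟩ : ∃ l : Fin k, (l : ℕ) = i + 1 := ⟨⟨i + 1, by omega⟩, rfl⟩
    have hl0 : l ≠ 0 := fun h => by simp [h] at hl
    have hli : l - 1 = i := Fin.ext (by rw [Fin.val_sub_one_of_ne_zero hl0]; omega)
    have hil : i < l := Fin.lt_def.2 (by omega)
    have hBD := sub_sub_one_mul_prod_X_mem_BDset η hl0 (A := A)
      (fun h => lt_asymm hil (hA l h)) (fun h => lt_irrefl _ (hA i (hli ▸ h)))
    rw [hli] at hBD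
    convert add_mem (Submodule.mem_sup_left (Submodule.subset_span hBD))
      (ih l (by omega) A fun j hj => (hA j hj).trans hil) using 1
    rw [Nat.cast_succ, C_add, C_1]
    ring

lemma prod_X_sub_factorial_mul_prod_X_mem {k : ℕ} [NeZero k] (η : ℝ) (n : ℕ) (hn : n ≤ k - 1) :
    (∏ j ∈ Finset.univ.filter (fun j : Fin k => (j : ℕ) < k - 1), X j) -
        C (n.factorial : ℂ) *
          ∏ j ∈ Finset.univ.filter (fun j : Fin k => (j : ℕ) < k - 1 - n), X j
      ∈ Submodule.span ℂ (BDset k η) ⊔ Submodule.span ℂ (Lset k 1 ∪ Lset k 2) := by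
  induction n with
  | zero => simp
  | succ n ih =>
    obtain ⟨i, hi⟩ : ∃ i : Fin k, (i : ℕ) = k - 1 - (n + 1) := ⟨⟨_, by omega⟩, rfl⟩
    have hfilter : Finset.univ.filter (fun j : Fin k => (j : ℕ) < k - 1 - n) =
        insert i (Finset.univ.filter (fun j : Fin k => (j : ℕ) < k - 1 - (n + 1))) := by
      ext j
      simp only [Finset.mem_filter_univ, Finset.mem_insert, Fin.ext_iff]
      omega
    have hstep := X_mul_prod_X_sub_mem η (n + 1) i (by omega)
      (Finset.univ.filter (fun j : Fin k => (j : ℕ) < k - 1 - (n + 1)))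
      (fun j hj => Fin.lt_def.2 (by rw [hi]; exact (Finset.mem_filter_univ j).1 hj))
    have ih := ih (by omega)
    rw [hfilter, Finset.prod_insert (by simp [hi])] at ih
    convert add_mem ih (Submodule.smul_mem _ (n.factorial : ℂ) hstep) using 1
    rw [smul_eq_C_mul, Nat.factorial_succ, Nat.cast_mul, C_mul]
    ring

/-- Lemma 4.8 of the paper: `z₁z₂⋯z_{k−1} − (k−1)! ∈ BD_k + span(L_k¹ ∪ L_k²)`. -/
theorem basic_foil (k : ℕ) [NeZero k] (η : ℝ) (hη : 0 < η) :
    (∏ j ∈ Finset.univ.filter (fun j : Fin k => (j : ℕ) < k - 1), X j) -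
        C (((k - 1).factorial : ℂ))
      ∈ Submodule.span ℂ (BDset k η) ⊔ Submodule.span ℂ (Lset k 1 ∪ Lset k 2) := by
  simpa using prod_X_sub_factorial_mul_prod_X_mem (k := k) η (k - 1) le_rfl
end

section
/- For every 1 ≤ i ≤ k−1, the polynomial z_1^2⋯z_{i−1}^2 · z_i z_{i+1}⋯z_{k−1} − ((k−1)!/(k−i)!) · z_1 z_2⋯z_{k−1} belongs to BD_k + span(L_k^1 ∪ L_k^2). -/
open MvPolynomial

/-- The monomial in `k` variables with exponent function `f`. -/
noncomputable def expMonomial {k : ℕ} (f : Fin k → ℕ) : MvPolynomial (Fin k) ℂ :=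
  ∏ j, X j ^ f j

theorem expMonomial_eq_monomial {k : ℕ} (f : Fin k → ℕ) :
    expMonomial f = monomial (Finsupp.equivFunOnFinite.symm f) 1 := by
  rw [monomial_eq, C_1, one_mul, Finsupp.prod_fintype _ _ (fun _ => pow_zero _)]
  rfl

theorem expMonomial_mem_Rspace {k : ℕ} {f : Fin k → ℕ} (hf : ∀ j, f j ≤ 2) :
    expMonomial f ∈ Rspace k :=
  Submodule.subset_span ⟨_, hf, expMonomial_eq_monomial f⟩

theorem expMonomial_mem_Lset {k i : ℕ} {f : Fin k → ℕ} (hf : ∀ j, f j ≤ 2)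
    (hi : ∀ j : Fin k, (j : ℕ) = k - 1 → f j = i) : expMonomial f ∈ Lset k i :=
  ⟨_, hf, hi, expMonomial_eq_monomial f⟩

theorem expMonomial_mul_X {k : ℕ} (f : Fin k → ℕ) (a : Fin k) :
    expMonomial f * X a = expMonomial (f + Pi.single a 1) := by
  simp only [expMonomial, Pi.add_apply, pow_add, Finset.prod_mul_distrib]
  congr 1
  rw [Finset.prod_eq_single a] <;> simp +contextual

theorem rename_swap_expMonomial {k : ℕ} {f : Fin k → ℕ} {a b : Fin k} (h : f a = f b) :
    rename (Equiv.swap a b) (expMonomial f) = expMonomial f := by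
  simp only [expMonomial, map_prod, map_pow, rename_X]
  refine Fintype.prod_equiv (Equiv.swap a b) _ _ fun j => ?_
  congr 1
  rw [Equiv.swap_apply_def]
  split_ifs with h1 h2 <;> simp_all

theorem mul_mem_BDset {k : ℕ} [NeZero k] (η : ℝ) {a b : Fin k} (hab : (a : ℕ) + 1 = b)
    {F : MvPolynomial (Fin k) ℂ} (hs : rename (Equiv.swap a b) F = F)
    (hR : (X a - X b - 1) * F ∈ Rspace k) : (X a - X b - 1) * F ∈ BDset k η := by
  have hb : b ≠ 0 := by
    rintro rfl
    simp at hab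
  have hba : b - 1 = a := by
    have : b = a + 1 := by
      apply Fin.ext
      rw [Fin.val_add, Fin.val_one', Nat.add_mod_mod, hab, Nat.mod_eq_of_lt b.2]
    rw [this, add_sub_cancel_right]
  refine ⟨hR, Pi.single b F, ?_, ?_, fun i _ => ?_, ?_⟩
  · simp [Pi.single_eq_of_ne hb.symm]
  · simp [Pi.single_eq_of_ne hb.symm]
  · by_cases h : i = b
    · subst h
      simpa [hba] using ⟨hs, hR⟩
    · simp [Pi.single_eq_of_ne h]
  · rw [Pi.single_eq_of_ne hb.symm, mul_zero, zero_add, Finset.sum_eq_single b]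
    · simp [hba]
    · intro i _ hi
      simp [Pi.single_eq_of_ne hi]
    · simp [hb]

/-- Exponent `0` in the last variable, `2` in the first `m` variables and in the one with
index `q`, and `1` elsewhere. -/
def foilExp (k m q : ℕ) (j : Fin k) : ℕ :=
  if (j : ℕ) = k - 1 then 0 else if (j : ℕ) < m ∨ (j : ℕ) = q then 2 else 1

theorem foilExp_le_two (k m q : ℕ) (j : Fin k) : foilExp k m q j ≤ 2 := by
  unfold foilExp
  split_ifs <;> omega

theorem foil_step_mem (k : ℕ) [NeZero k] (η : ℝ) {m q : ℕ} (hmq : m ≤ q) (hq : q + 1 < k - 1) :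
    expMonomial (foilExp k m q) - expMonomial (foilExp k m (q + 1)) -
      expMonomial (foilExp k m (k - 1)) ∈ Submodule.span ℂ (BDset k η) := by
  let a : Fin k := ⟨q, by omega⟩
  let b : Fin k := ⟨q + 1, by omega⟩
  have ha : expMonomial (foilExp k m (k - 1)) * X a = expMonomial (foilExp k m q) := by
    rw [expMonomial_mul_X]
    congr 1
    ext j
    simp only [foilExp, Pi.add_apply, Pi.single_apply, Fin.ext_iff, a]
    split_ifs <;> omega
  have hb : expMonomial (foilExp k m (k - 1)) * X b = expMonomial (foilExp k m (q + 1)) := by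
    rw [expMonomial_mul_X]
    congr 1
    ext j
    simp only [foilExp, Pi.add_apply, Pi.single_apply, Fin.ext_iff, b]
    split_ifs <;> omega
  have key : expMonomial (foilExp k m q) - expMonomial (foilExp k m (q + 1)) -
      expMonomial (foilExp k m (k - 1)) =
      (X a - X b - 1) * expMonomial (foilExp k m (k - 1)) := by
    rw [← ha, ← hb]
    ring
  have hR : expMonomial (foilExp k m q) - expMonomial (foilExp k m (q + 1)) -
      expMonomial (foilExp k m (k - 1)) ∈ Rspace k :=
    sub_mem (sub_mem (expMonomial_mem_Rspace (foilExp_le_two _ _ _))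
      (expMonomial_mem_Rspace (foilExp_le_two _ _ _)))
      (expMonomial_mem_Rspace (foilExp_le_two _ _ _))
  rw [key] at hR ⊢
  refine Submodule.subset_span (mul_mem_BDset η rfl (rename_swap_expMonomial ?_) hR)
  simp only [foilExp, a, b]
  split_ifs <;> omega

theorem foil_last_mem (k : ℕ) [NeZero k] (η : ℝ) {m q : ℕ} (hmq : m ≤ q) (hq : q + 1 = k - 1) :
    expMonomial (foilExp k m q) - expMonomial (foilExp k m (k - 1)) ∈
      Submodule.span ℂ (BDset k η) ⊔ Submodule.span ℂ (Lset k 1 ∪ Lset k 2) := by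
  let a : Fin k := ⟨q, by omega⟩
  let b : Fin k := ⟨q + 1, by omega⟩
  let f : Fin k → ℕ := fun j => if (j : ℕ) < m then 2 else if (j : ℕ) < q then 1 else 0
  have ha : expMonomial f * X a = expMonomial (foilExp k m (k - 1)) := by
    rw [expMonomial_mul_X]
    congr 1
    ext j
    have := j.2
    simp only [f, foilExp, Pi.add_apply, Pi.single_apply, Fin.ext_iff, a]
    split_ifs <;> omega
  have haa : expMonomial f * X a * X a = expMonomial (foilExp k m q) := by
    rw [expMonomial_mul_X, expMonomial_mul_X]
    congr 1
    ext j
    have := j.2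
    simp only [f, foilExp, Pi.add_apply, Pi.single_apply, Fin.ext_iff, a]
    split_ifs <;> omega
  have hb2 (j : Fin k) : (f + Pi.single b 1 : Fin k → ℕ) j ≤ 2 := by
    simp only [f, Pi.add_apply, Pi.single_apply, Fin.ext_iff, b]
    split_ifs <;> omega
  have hbb2 (j : Fin k) : (f + Pi.single b 1 + Pi.single b 1 : Fin k → ℕ) j ≤ 2 := by
    simp only [f, Pi.add_apply, Pi.single_apply, Fin.ext_iff, b]
    split_ifs <;> omega
  have hb : expMonomial f * X b ∈ Lset k 1 := by
    rw [expMonomial_mul_X]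
    refine expMonomial_mem_Lset hb2 fun j hj => ?_
    simp only [f, Pi.add_apply, Pi.single_apply, Fin.ext_iff, b]
    split_ifs <;> omega
  have hbb : expMonomial f * X b * X b ∈ Lset k 2 := by
    rw [expMonomial_mul_X, expMonomial_mul_X]
    refine expMonomial_mem_Lset hbb2 fun j hj => ?_
    simp only [f, Pi.add_apply, Pi.single_apply, Fin.ext_iff, b]
    split_ifs <;> omega
  have key : (X a - X b - 1) * (expMonomial f * (X a + X b)) =
      expMonomial f * X a * X a - expMonomial f * X a - expMonomial f * X b * X b -
        expMonomial f * X b := by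
    ring
  have hBD : (X a - X b - 1) * (expMonomial f * (X a + X b)) ∈ BDset k η := by
    refine mul_mem_BDset η rfl ?_ ?_
    · have hf : f a = f b := by
        simp only [f, a, b]
        split_ifs <;> omega
      rw [map_mul, rename_swap_expMonomial hf, map_add, rename_X, rename_X,
        Equiv.swap_apply_left, Equiv.swap_apply_right, add_comm (X b)]
    · rw [key, haa, ha, expMonomial_mul_X f b, expMonomial_mul_X]
      exact sub_mem (sub_mem (sub_mem (expMonomial_mem_Rspace (foilExp_le_two _ _ _))
        (expMonomial_mem_Rspace (foilExp_le_two _ _ _))) (expMonomial_mem_Rspace hbb2))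
        (expMonomial_mem_Rspace hb2)
  have hsum : expMonomial (foilExp k m q) - expMonomial (foilExp k m (k - 1)) =
      (X a - X b - 1) * (expMonomial f * (X a + X b)) +
        (expMonomial f * X b * X b + expMonomial f * X b) := by
    rw [key, ← haa, ← ha]
    ring
  rw [hsum]
  exact add_mem (Submodule.mem_sup_left (Submodule.subset_span hBD)) <|
    Submodule.mem_sup_right <| add_mem (Submodule.subset_span (Or.inr hbb))
      (Submodule.subset_span (Or.inl hb))

theorem foil_move_mem (k : ℕ) [NeZero k] (η : ℝ) {m : ℕ} (d : ℕ) :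
    ∀ q, m ≤ q → q + d + 1 = k - 1 →
      expMonomial (foilExp k m q) - ((d + 1 : ℕ) : ℂ) • expMonomial (foilExp k m (k - 1)) ∈
        Submodule.span ℂ (BDset k η) ⊔ Submodule.span ℂ (Lset k 1 ∪ Lset k 2) := by
  induction d with
  | zero =>
    intro q hmq hq
    simpa using foil_last_mem k η hmq hq
  | succ d ih =>
    intro q hmq hq
    have h := add_mem (Submodule.mem_sup_left (foil_step_mem k η hmq (by omega)))
      (ih (q + 1) (by omega) (by omega))
    convert h using 1
    push_cast
    module

theorem foil_factorial_mem (k : ℕ) [NeZero k] (η : ℝ) (m : ℕ) (hm : m ≤ k - 1) :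
    expMonomial (foilExp k m (k - 1)) -
      (((k - 1).factorial : ℂ) / ((k - 1 - m).factorial : ℂ)) •
        expMonomial (foilExp k 0 (k - 1)) ∈
      Submodule.span ℂ (BDset k η) ⊔ Submodule.span ℂ (Lset k 1 ∪ Lset k 2) := by
  induction m with
  | zero =>
    simp [div_self (Nat.cast_ne_zero.mpr (Nat.factorial_ne_zero (k - 1)) : _ ≠ (0 : ℂ))]
  | succ m ih =>
    obtain ⟨d, hd⟩ : ∃ d, m + d + 1 = k - 1 := ⟨k - 1 - (m + 1), by omega⟩
    have hE : foilExp k (m + 1) (k - 1) = foilExp k m m := by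
      ext j
      simp only [foilExp]
      split_ifs <;> omega
    have h := add_mem (foil_move_mem k η d m le_rfl hd)
      (Submodule.smul_mem _ ((d + 1 : ℕ) : ℂ) (ih (by omega)))
    rw [hE]
    convert h using 1
    have h1 : k - 1 - (m + 1) = d := by omega
    have h2 : k - 1 - m = d + 1 := by omega
    have hc : ((k - 1).factorial : ℂ) / (d.factorial : ℂ) =
        ((d + 1 : ℕ) : ℂ) * (((k - 1).factorial : ℂ) / ((d + 1).factorial : ℂ)) := by
      have h3 : (d.factorial : ℂ) ≠ 0 := Nat.cast_ne_zero.mpr d.factorial_ne_zero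
      have h4 : ((d + 1 : ℕ) : ℂ) ≠ 0 := Nat.cast_ne_zero.mpr d.succ_ne_zero
      rw [Nat.factorial_succ, Nat.cast_mul]
      field_simp
    rw [h1, h2, hc]
    module

/-- Lemma 4.10 of the paper: for `1 ≤ i ≤ k−1`,
`z₁²⋯z_{i−1}² z_i z_{i+1}⋯z_{k−1} − ((k−1)!/(k−i)!) z₁⋯z_{k−1} ∈ BD_k + span(L_k¹ ∪ L_k²)`. -/
theorem foil_up_full (k : ℕ) [NeZero k] (η : ℝ) (hη : 0 < η)
    (i : ℕ) (hi1 : 1 ≤ i) (hi2 : i ≤ k - 1) :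
    (∏ j ∈ Finset.univ.filter (fun j : Fin k => (j : ℕ) < i - 1), X j ^ 2) *
        (∏ j ∈ Finset.univ.filter (fun j : Fin k => i - 1 ≤ (j : ℕ) ∧ (j : ℕ) < k - 1), X j) -
        C (((k - 1).factorial : ℂ) / ((k - i).factorial : ℂ)) *
          ∏ j ∈ Finset.univ.filter (fun j : Fin k => (j : ℕ) < k - 1), X j
      ∈ Submodule.span ℂ (BDset k η) ⊔ Submodule.span ℂ (Lset k 1 ∪ Lset k 2) := by
  have h := foil_factorial_mem k η (i - 1) (by omega)
  rw [show k - 1 - (i - 1) = k - i by omega, smul_eq_C_mul] at h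
  convert h using 2
  · simp only [expMonomial, Finset.prod_filter, ← Finset.prod_mul_distrib]
    refine Finset.prod_congr rfl fun j _ => ?_
    have := j.2
    simp only [foilExp]
    split_ifs <;> first | omega | simp
  · congr 1
    simp only [expMonomial, Finset.prod_filter]
    refine Finset.prod_congr rfl fun j _ => ?_
    have := j.2
    simp only [foilExp]
    split_ifs <;> first | omega | simp
end

section
/- For all real numbers μ, η > 0 and all integers 0 ≤ r ≤ k, the following Pochhammer identity holds: C(k,r)·(η)_{k−r}^2·(η+μ)_k = (η+μ)_{k−r} · ∑_{i=0}^{k} C(k,i)·(μ)_i·(η)_{k−i} · ∑_{ℓ=0}^{k−r} C(i,ℓ)·C(k−i, k−r−ℓ)·(η+k−r−ℓ)_ℓ·(η−μ)_{k−r−ℓ}, where C(·,·) denotes binomial coefficients (equal to 0 when the lower index exceeds the upper index). Equivalently, the coefficient of x_1^2⋯x_r^2 in L_{r,k}(P_k) vanishes for all 0 ≤ r ≤ k. -/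
open Polynomial in
/-- The value of a rising factorial of a sum of exponents. -/
theorem ascPochhammer_eval_add_index {R : Type*} [CommSemiring R] (a : R) (m n : ℕ) :
    (ascPochhammer R (m + n)).eval a =
      (ascPochhammer R m).eval a * (ascPochhammer R n).eval (a + m) := by
  rw [← ascPochhammer_mul, eval_mul, eval_comp]
  simp

open Finset in
/-- The Chu–Vandermonde identity for rising factorials. -/
theorem ascPochhammer_eval_add {R : Type*} [CommSemiring R] (a b : R) (n : ℕ) :
    (ascPochhammer R n).eval (a + b) =
      ∑ ij ∈ antidiagonal n, (n.choose ij.1 : R) *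
        ((ascPochhammer R ij.1).eval a * (ascPochhammer R ij.2).eval b) := by
  induction n with
  | zero => simp
  | succ n ih =>
    rw [sum_antidiagonal_choose_succ_mul fun i j =>
      (ascPochhammer R i).eval a * (ascPochhammer R j).eval b,
      ← sum_add_distrib, ascPochhammer_succ_eval, ih, sum_mul]
    refine sum_congr rfl fun ij hij => ?_
    have h := mem_antidiagonal.mp hij
    rw [← Nat.choose_symm_of_eq_add h.symm, ascPochhammer_succ_eval, ascPochhammer_succ_eval, ← h]
    push_cast
    ring

/-- Two ways to write the number of partitions of a set into parts of sizes `l`, `j`, `p`, `s`. -/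
theorem Nat.choose_mul_choose_mul_choose_comm (l j p s : ℕ) :
    (l + j + (p + s)).choose (l + j) * (l + j).choose l * (p + s).choose p =
      (l + p + (j + s)).choose (l + p) * (l + p).choose l * (j + s).choose j := by
  have h : l + j + (p + s) = l + p + (j + s) := by ring
  apply Nat.cast_injective (R := ℚ)
  push_cast [Nat.cast_add_choose]
  rw [h]
  field_simp

open Finset in
/-- A sum weighted by `i.choose l * (k - i).choose p` is supported on `l ≤ i ≤ k - p`. -/
theorem Finset.sum_range_choose_mul_choose {R : Type*} [CommSemiring R] (l p r : ℕ) (f : ℕ → R) :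
    ∑ i ∈ range (l + p + r + 1), (i.choose l : R) * ((l + p + r - i).choose p : R) * f i =
      ∑ js ∈ antidiagonal r,
        ((l + js.1).choose l : R) * ((p + js.2).choose p : R) * f (l + js.1) := by
  rw [show l + p + r + 1 = l + (r + 1 + p) by ring, sum_range_add, sum_range_add,
    Nat.sum_antidiagonal_eq_sum_range_succ
      (fun j s => ((l + j).choose l : R) * ((p + s).choose p : R) * f (l + j)),
    sum_eq_zero (s := range l), sum_eq_zero (s := range p), zero_add, add_zero]
  · refine sum_congr rfl fun j hj => ?_
    have := mem_range.mp hj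
    rw [show l + p + r - (l + j) = p + (r - j) by lia]
  · intro x hx
    have := mem_range.mp hx
    rw [Nat.choose_eq_zero_of_lt (show l + p + r - (l + (r + 1 + x)) < p by lia)]
    simp
  · intro x hx
    rw [Nat.choose_eq_zero_of_lt (mem_range.mp hx)]
    simp

open Finset in
/-- The inner sum, over the index `i`, after exchanging the order of summation. -/
theorem sum_choose_mul_ascPochhammer {R : Type*} [CommRing R] (a b : R) (l p r : ℕ) :
    ∑ i ∈ range (l + p + r + 1), (i.choose l : R) * ((l + p + r - i).choose p : R) *
        (((l + p + r).choose i : R) * (ascPochhammer R i).eval a *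
          (ascPochhammer R (l + p + r - i)).eval b) =
      ((l + p + r).choose (l + p) : R) * ((l + p).choose l : R) * (ascPochhammer R l).eval a *
        (ascPochhammer R p).eval b * (ascPochhammer R r).eval (b + a + (l + p : ℕ)) := by
  rw [sum_range_choose_mul_choose,
    show b + a + (l + p : ℕ) = (a + l) + (b + p) by push_cast; ring,
    ascPochhammer_eval_add, mul_sum]
  refine sum_congr rfl fun js hjs => ?_
  obtain ⟨j, s⟩ := js
  obtain rfl : j + s = r := mem_antidiagonal.mp hjs
  have h := congrArg (Nat.cast (R := R)) (Nat.choose_mul_choose_mul_choose_comm l j p s)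
  have e : l + j + (p + s) = l + p + (j + s) := by ring
  push_cast [e] at h
  simp only [show l + p + (j + s) - (l + j) = p + s by lia, ascPochhammer_eval_add_index]
  linear_combination (ascPochhammer R l).eval a * (ascPochhammer R j).eval (a + l) *
    ((ascPochhammer R p).eval b * (ascPochhammer R s).eval (b + p)) * h


/-- The Pochhammer identity `C_{r,k} = 0` from the proof of Proposition 2.4 of the paper:
for all `μ, η > 0` and `0 ≤ r ≤ k`,
`C(k,r)·(η)_{k−r}²·(η+μ)_k = (η+μ)_{k−r} · ∑_{i=0}^k C(k,i)(μ)_i(η)_{k−i}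
  · ∑_{ℓ=0}^{k−r} C(i,ℓ)C(k−i,k−r−ℓ)(η+k−r−ℓ)_ℓ(η−μ)_{k−r−ℓ}`. -/
theorem pochhammer_identity (μ η : ℝ) (hμ : 0 < μ) (hη : 0 < η) (k r : ℕ) (hr : r ≤ k) :
    (k.choose r : ℝ) * ((ascPochhammer ℝ (k - r)).eval η) ^ 2 *
        (ascPochhammer ℝ k).eval (η + μ) =
      (ascPochhammer ℝ (k - r)).eval (η + μ) *
        ∑ i ∈ Finset.range (k + 1),
          (k.choose i : ℝ) * (ascPochhammer ℝ i).eval μ *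
            (ascPochhammer ℝ (k - i)).eval η *
            ∑ ℓ ∈ Finset.range (k - r + 1),
              (i.choose ℓ : ℝ) * ((k - i).choose (k - r - ℓ) : ℝ) *
                (ascPochhammer ℝ ℓ).eval (η + (k - r - ℓ : ℕ)) *
                (ascPochhammer ℝ (k - r - ℓ)).eval (η - μ) := by
  obtain ⟨m, rfl⟩ := Nat.exists_eq_add_of_le' hr
  simp only [Nat.add_sub_cancel, Finset.mul_sum]
  rw [Finset.sum_comm, ← Nat.choose_symm_add]
  have inner : ∀ ℓ ∈ Finset.range (m + 1),
      ∑ i ∈ Finset.range (m + r + 1), (ascPochhammer ℝ m).eval (η + μ) *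
        (((m + r).choose i : ℝ) * (ascPochhammer ℝ i).eval μ *
          (ascPochhammer ℝ (m + r - i)).eval η *
          ((i.choose ℓ : ℝ) * ((m + r - i).choose (m - ℓ) : ℝ) *
            (ascPochhammer ℝ ℓ).eval (η + (m - ℓ : ℕ)) *
            (ascPochhammer ℝ (m - ℓ)).eval (η - μ))) =
      ((m + r).choose m : ℝ) * (ascPochhammer ℝ m).eval η *
        (ascPochhammer ℝ (m + r)).eval (η + μ) *
        ((m.choose ℓ : ℝ) *
          ((ascPochhammer ℝ ℓ).eval μ * (ascPochhammer ℝ (m - ℓ)).eval (η - μ))) := by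
    intro ℓ hℓ
    obtain ⟨p, rfl⟩ := Nat.exists_eq_add_of_le (Finset.mem_range_succ_iff.mp hℓ)
    have h := sum_choose_mul_ascPochhammer μ η ℓ p r
    have split_index : (ascPochhammer ℝ (ℓ + p)).eval η =
        (ascPochhammer ℝ p).eval η * (ascPochhammer ℝ ℓ).eval (η + p) := by
      rw [add_comm ℓ p, ascPochhammer_eval_add_index]
    rw [Nat.add_sub_cancel_left, split_index, ascPochhammer_eval_add_index (η + μ) (ℓ + p) r]
    trans (ascPochhammer ℝ (ℓ + p)).eval (η + μ) * (ascPochhammer ℝ ℓ).eval (η + p) *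
      (ascPochhammer ℝ p).eval (η - μ) * ∑ i ∈ Finset.range (ℓ + p + r + 1),
        (i.choose ℓ : ℝ) * ((ℓ + p + r - i).choose p : ℝ) *
          (((ℓ + p + r).choose i : ℝ) * (ascPochhammer ℝ i).eval μ *
            (ascPochhammer ℝ (ℓ + p + r - i)).eval η)
    · rw [Finset.mul_sum]
      exact Finset.sum_congr rfl fun i _ => by ring
    · rw [h]
      ring
  rw [Finset.sum_congr rfl inner, ← Finset.mul_sum]
  have h := ascPochhammer_eval_add μ (η - μ) m
  rw [add_sub_cancel, Finset.Nat.sum_antidiagonal_eq_sum_range_succ (fun i j =>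
    (m.choose i : ℝ) * ((ascPochhammer ℝ i).eval μ * (ascPochhammer ℝ j).eval (η - μ)))] at h
  rw [← h]
  ring
end

section
/- For every real ν > 1/2 there exists a constant C > 0 such that |F_ν(x)| ≤ C for every real x ≤ 0. -/
open MeasureTheory ProbabilityTheory Filter Topology

/-- The function `F_ν(x) = ∑_{k=0}^∞ x^k/(k!·(ν)_k)`, where `(ν)_k` is the Pochhammer
symbol. -/
noncomputable def Fnu (ν : ℝ) (x : ℝ) : ℝ :=
  ∑' k : ℕ, x ^ k / (k.factorial * (ascPochhammer ℝ k).eval ν)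

theorem ascPochhammer_eval_succ_left (ν : ℝ) (k : ℕ) :
    (ascPochhammer ℝ (k + 1)).eval ν = ν * (ascPochhammer ℝ k).eval (ν + 1) := by
  simp [ascPochhammer_succ_left, Polynomial.eval_comp]

theorem pow_le_ascPochhammer_eval {ν : ℝ} (hν : 0 < ν) (k : ℕ) :
    ν ^ k ≤ (ascPochhammer ℝ k).eval ν := by
  induction k with
  | zero => simp
  | succ k ih =>
    rw [ascPochhammer_succ_eval, pow_succ]
    have : (0 : ℝ) ≤ k := k.cast_nonneg
    have hp := ascPochhammer_pos k ν hν
    gcongr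
    linarith

theorem summable_Fnu {ν : ℝ} (hν : 0 < ν) (x : ℝ) :
    Summable fun k : ℕ ↦ x ^ k / (k.factorial * (ascPochhammer ℝ k).eval ν) := by
  refine Summable.of_norm_bounded (Real.summable_pow_div_factorial (|x| / ν)) fun k ↦ ?_
  have hp := ascPochhammer_pos k ν hν
  rw [Real.norm_eq_abs, abs_div, abs_pow, div_pow, div_div, mul_comm (ν ^ k),
    abs_of_pos (by positivity : (0 : ℝ) < k.factorial * (ascPochhammer ℝ k).eval ν)]
  gcongr
  exact pow_le_ascPochhammer_eval hν k

theorem Fnu_zero (ν : ℝ) : Fnu ν 0 = 1 := by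
  rw [Fnu, tsum_eq_single 0 fun k hk ↦ by simp [hk]]
  simp

theorem Fnu_term_deriv_succ {ν : ℝ} (hν : 0 < ν) (x : ℝ) (k : ℕ) :
    ((k + 1 : ℕ) : ℝ) * x ^ (k + 1 - 1) /
        ((k + 1).factorial * (ascPochhammer ℝ (k + 1)).eval ν) =
      x ^ k / (k.factorial * (ascPochhammer ℝ k).eval (ν + 1)) / ν := by
  have hp := ascPochhammer_pos k (ν + 1) (by linarith)
  rw [ascPochhammer_eval_succ_left, Nat.factorial_succ, Nat.add_sub_cancel]
  push_cast
  field_simp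

theorem summable_Fnu_term_deriv {ν : ℝ} (hν : 0 < ν) (x : ℝ) :
    Summable fun k : ℕ ↦
      (k : ℝ) * x ^ (k - 1) / (k.factorial * (ascPochhammer ℝ k).eval ν) := by
  rw [← summable_nat_add_iff 1]
  simp only [Fnu_term_deriv_succ hν]
  exact (summable_Fnu (by linarith) x).div_const ν

theorem hasDerivAt_Fnu {ν : ℝ} (hν : 0 < ν) (x : ℝ) :
    HasDerivAt (Fnu ν) (Fnu (ν + 1) x / ν) x := by
  have hx : x ∈ Metric.ball (0 : ℝ) (|x| + 1) := by simp
  have h := hasDerivAt_tsum_of_isPreconnected (summable_Fnu_term_deriv hν (|x| + 1))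
    Metric.isOpen_ball (convex_ball (0 : ℝ) (|x| + 1)).isPreconnected
    (fun k y _ ↦ (hasDerivAt_pow k y).div_const
      (k.factorial * (ascPochhammer ℝ k).eval ν))
    (fun k y hy ↦ by
      have hp := ascPochhammer_pos k ν hν
      have hy' : |y| ≤ |x| + 1 := by simpa using (mem_ball_zero_iff.1 hy).le
      rw [Real.norm_eq_abs, abs_div, abs_mul, abs_pow, Nat.abs_cast,
        abs_of_pos (by positivity : (0 : ℝ) < k.factorial * (ascPochhammer ℝ k).eval ν)]
      gcongr)
    hx (summable_Fnu hν x) hx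
  refine h.congr_deriv ?_
  rw [(summable_Fnu_term_deriv hν x).tsum_eq_zero_add]
  simp only [Fnu_term_deriv_succ hν, tsum_div_const]
  simp [Fnu]

theorem Fnu_recurrence {ν : ℝ} (hν : 0 < ν) (x : ℝ) :
    Fnu ν x = Fnu (ν + 1) x + x * (Fnu (ν + 1 + 1) x / (ν + 1) / ν) := by
  have h1 := summable_Fnu hν x
  have h2 := summable_Fnu (by linarith : 0 < ν + 1) x
  have h3 := summable_Fnu (by linarith : 0 < ν + 1 + 1) x
  have key (k : ℕ) : x ^ (k + 1) / ((k + 1).factorial * (ascPochhammer ℝ (k + 1)).eval ν) =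
      x ^ (k + 1) / ((k + 1).factorial * (ascPochhammer ℝ (k + 1)).eval (ν + 1)) +
      x * (x ^ k / (k.factorial * (ascPochhammer ℝ k).eval (ν + 1 + 1)) / (ν + 1) / ν) := by
    have hp := ascPochhammer_pos k (ν + 1) (by linarith)
    have hk : (0 : ℝ) ≤ k := k.cast_nonneg
    have hq : (ascPochhammer ℝ k).eval (ν + 1 + 1) =
        (ascPochhammer ℝ k).eval (ν + 1) * (ν + 1 + k) / (ν + 1) := by
      rw [← ascPochhammer_succ_eval, ascPochhammer_eval_succ_left]
      field_simp
    rw [ascPochhammer_eval_succ_left ν, ascPochhammer_succ_eval k (ν + 1), hq,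
      Nat.factorial_succ]
    push_cast
    field_simp
    ring
  unfold Fnu
  rw [h1.tsum_eq_zero_add, h2.tsum_eq_zero_add, tsum_congr key,
    ((summable_nat_add_iff 1).2 h2).tsum_add
      (((h3.div_const (ν + 1)).div_const ν).mul_left x),
    tsum_mul_left, tsum_div_const, tsum_div_const]
  simp only [pow_zero, Nat.factorial_zero, ascPochhammer_zero, Polynomial.eval_one]
  ring

/-- The energy `F² - x F'²` of the differential equation `x F'' + ν F' = F` is monotone. -/
theorem monotone_Fnu_energy {ν : ℝ} (hν : 1 / 2 < ν) :
    Monotone fun x ↦ Fnu ν x ^ 2 - x * (Fnu (ν + 1) x / ν) ^ 2 := by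
  have h0 : 0 < ν := by linarith
  refine monotone_of_hasDerivAt_nonneg
    (f' := fun x ↦ (2 * ν - 1) * (Fnu (ν + 1) x / ν) ^ 2) (fun x ↦ ?_) fun x ↦ ?_
  · have hF := hasDerivAt_Fnu h0 x
    have hF' := (hasDerivAt_Fnu (by linarith : 0 < ν + 1) x).div_const ν
    refine ((hF.pow 2).sub ((hasDerivAt_id x).mul (hF'.pow 2))).congr_deriv ?_
    have hx := Fnu_recurrence h0 x
    generalize Fnu (ν + 1 + 1) x / (ν + 1) / ν = c at hx ⊢
    have hd : Fnu (ν + 1) x = ν * (Fnu (ν + 1) x / ν) := by field_simp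
    rw [hd] at hx
    simp only [id, Pi.pow_apply]
    generalize Fnu (ν + 1) x / ν = d at hx ⊢
    rw [hx]
    ring
  · have : 0 ≤ 2 * ν - 1 := by linarith
    positivity

/-- Lemma 4.15 of the paper: for `ν > 1/2`, the function `F_ν` is bounded on `(−∞,0]`. -/
theorem Fnu_bounded_on_nonpos (ν : ℝ) (hν : 1 / 2 < ν) :
    ∃ C > 0, ∀ x ≤ (0 : ℝ), |Fnu ν x| ≤ C := by
  refine ⟨1, one_pos, fun x hx ↦ ?_⟩
  have h := monotone_Fnu_energy hν hx
  simp only [Fnu_zero, zero_mul, sub_zero] at h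
  rw [← sq_le_one_iff_abs_le_one]
  nlinarith [mul_nonneg (neg_nonneg.2 hx) (sq_nonneg (Fnu (ν + 1) x / ν))]
end
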